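/- Banach algebra property of weighted Sobolev spaces: Let n ≥ 1, s ∈ ℕ with s > n/2, and δ ∈ ℝ with δ > −n/2. Then there is a constant C, depending only on n, s, δ, such that for all smooth functions f, g : ℝⁿ → ℝ with ‖f‖_{H_{s,δ}(ℝⁿ)} < ∞ and ‖g‖_{H_{s,δ}(ℝⁿ)} < ∞, one has ‖f·g‖_{H_{s,δ}(ℝⁿ)} ≤ C ‖f‖_{H_{s,δ}(ℝⁿ)} ‖g‖_{H_{s,δ}(ℝⁿ)}. -/

import Mathlib

open MeasureTheory

/-- The weighted Sobolev norm `‖u‖_{H_{s,δ}(ℝⁿ)}`, valued in `ℝ≥0∞`: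
`(Σ_{k=0}^{s} ∫ σ(x)^{2(δ+k)} ‖Dᵏu(x)‖² dx)^{1/2}` where `σ(x) = (1+|x|²)^{1/2}`. -/
noncomputable def wSob (n s : ℕ) (δ : ℝ) (u : EuclideanSpace ℝ (Fin n) → ℝ) : ENNReal :=
  (∑ k ∈ Finset.range (s + 1),
    ∫⁻ x : EuclideanSpace ℝ (Fin n),
      ENNReal.ofReal ((1 + ‖x‖ ^ 2) ^ (δ + (k : ℝ)) * ‖iteratedFDeriv ℝ k u x‖ ^ 2)) ^ (1/2 : ℝ)

open scoped ENNReal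

theorem sq_lintegral_mul_le {α : Type*} [MeasurableSpace α] (μ : Measure α) {f g : α → ℝ≥0∞}
    (hf : AEMeasurable f μ) (hg : AEMeasurable g μ) :
    (∫⁻ x, f x * g x ∂μ) ^ 2 ≤ (∫⁻ x, f x ^ 2 ∂μ) * ∫⁻ x, g x ^ 2 ∂μ := by
  have h := ENNReal.lintegral_mul_le_Lp_mul_Lq μ Real.HolderConjugate.two_two hf hg
  simp only [Pi.mul_apply, ENNReal.rpow_two] at h
  have h2 : ∀ a : ℝ≥0∞, (a ^ (1 / 2 : ℝ)) ^ 2 = a := fun a => by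
    rw [← ENNReal.rpow_natCast, ← ENNReal.rpow_mul]; norm_num
  calc _ ≤ _ := pow_le_pow_left' h 2
    _ = _ := by rw [mul_pow, h2, h2]

theorem add_pow_le_two_pow_mul (a b : ℝ≥0∞) (k : ℕ) :
    (a + b) ^ k ≤ 2 ^ k * (a ^ k + b ^ k) := by
  wlog h : a ≤ b generalizing a b
  · rw [add_comm a, add_comm (a ^ k)]
    exact this b a (le_of_not_ge h)
  calc (a + b) ^ k ≤ (2 * b) ^ k := by rw [two_mul]; gcongr
    _ = 2 ^ k * b ^ k := mul_pow _ _ _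
    _ ≤ _ := by gcongr; exact le_add_self

section Convolution

variable {E : Type*} [NormedAddCommGroup E] [MeasurableSpace E] [BorelSpace E]
  [SecondCountableTopology E] (μ : Measure E) [SFinite μ] [μ.IsAddLeftInvariant]
  [μ.IsNegInvariant]

theorem lintegral_sq_lintegral_mul_sub_le {f g : E → ℝ≥0∞}
    (hf : Measurable f) (hg : Measurable g) :
    ∫⁻ x, (∫⁻ y, f y * g (x - y) ∂μ) ^ 2 ∂μ ≤ (∫⁻ x, f x ^ 2 ∂μ) * (∫⁻ x, g x ∂μ) ^ 2 := by
  have h2 : ∀ a : ℝ≥0∞, (a ^ (1 / 2 : ℝ)) ^ 2 = a := fun a => by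
    rw [← ENNReal.rpow_natCast, ← ENNReal.rpow_mul]; norm_num
  have key : ∀ x, (∫⁻ y, f y * g (x - y) ∂μ) ^ 2
      ≤ (∫⁻ y, f y ^ 2 * g (x - y) ∂μ) * ∫⁻ y, g y ∂μ := fun x => by
    have h := sq_lintegral_mul_le μ (f := fun y => f y * (g (x - y)) ^ (1 / 2 : ℝ))
      (g := fun y => (g (x - y)) ^ (1 / 2 : ℝ)) (by fun_prop) (by fun_prop)
    simp only [mul_pow, h2, mul_assoc, ← sq] at h
    rwa [lintegral_sub_left_eq_self (fun y => g y) x] at h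
  calc _ ≤ ∫⁻ x, (∫⁻ y, f y ^ 2 * g (x - y) ∂μ) * ∫⁻ y, g y ∂μ ∂μ := lintegral_mono key
    _ = (∫⁻ x, ∫⁻ y, f y ^ 2 * g (x - y) ∂μ ∂μ) * ∫⁻ y, g y ∂μ := by
      rw [lintegral_mul_const]
      exact Measurable.lintegral_prod_right' (f := fun p : E × E => f p.2 ^ 2 * g (p.1 - p.2))
        (by fun_prop)
    _ = (∫⁻ y, ∫⁻ x, f y ^ 2 * g (x - y) ∂μ ∂μ) * ∫⁻ y, g y ∂μ := by
      rw [lintegral_lintegral_swap]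
      fun_prop
    _ = (∫⁻ y, f y ^ 2 * ∫⁻ x, g x ∂μ ∂μ) * ∫⁻ y, g y ∂μ := by
      congr 2 with y
      rw [lintegral_const_mul _ (by fun_prop), lintegral_sub_right_eq_self (fun x => g x)]
    _ = _ := by rw [lintegral_mul_const _ (by fun_prop), mul_assoc, sq]

theorem lintegral_sq_lintegral_mul_sub_le' {f g : E → ℝ≥0∞}
    (hf : Measurable f) (hg : Measurable g) :
    ∫⁻ x, (∫⁻ y, f y * g (x - y) ∂μ) ^ 2 ∂μ ≤ (∫⁻ x, f x ∂μ) ^ 2 * ∫⁻ x, g x ^ 2 ∂μ := by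
  rw [mul_comm]
  refine le_trans (le_of_eq ?_) (lintegral_sq_lintegral_mul_sub_le μ hg hf)
  congr 1 with x
  rw [← lintegral_sub_left_eq_self _ x]
  simp [mul_comm]

omit [NormedAddCommGroup E] [BorelSpace E] [SecondCountableTopology E] [SFinite μ]
  [μ.IsAddLeftInvariant] [μ.IsNegInvariant] in
theorem sq_lintegral_le_weight {w f : E → ℝ≥0∞} (hw : Measurable w) (hf : Measurable f)
    (hw0 : ∀ x, w x ≠ 0) (hwt : ∀ x, w x ≠ ∞) :
    (∫⁻ x, f x ∂μ) ^ 2 ≤ (∫⁻ x, (w x)⁻¹ ^ 2 ∂μ) * ∫⁻ x, (w x * f x) ^ 2 ∂μ := by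
  refine le_trans (le_of_eq ?_) (sq_lintegral_mul_le μ (f := fun x => (w x)⁻¹)
    (g := fun x => w x * f x) (by fun_prop) (by fun_prop))
  congr 2 with x
  rw [← mul_assoc, ENNReal.inv_mul_cancel (hw0 x) (hwt x), one_mul]

theorem lintegral_sq_weight_mul_conv_le {w f g : E → ℝ≥0∞} {K : ℝ≥0∞} (hw : Measurable w)
    (hw0 : ∀ x, w x ≠ 0) (hwt : ∀ x, w x ≠ ∞) (hwK : ∀ x y, w x ≤ K * (w y + w (x - y)))
    (hf : Measurable f) (hg : Measurable g) :
    ∫⁻ x, (w x * ∫⁻ y, f y * g (x - y) ∂μ) ^ 2 ∂μ ≤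
      K ^ 2 * 8 * (∫⁻ x, (w x)⁻¹ ^ 2 ∂μ) * (∫⁻ x, (w x * f x) ^ 2 ∂μ) *
        ∫⁻ x, (w x * g x) ^ 2 ∂μ := by
  set J := ∫⁻ x, (w x)⁻¹ ^ 2 ∂μ
  set A := ∫⁻ x, (w x * f x) ^ 2 ∂μ
  set B := ∫⁻ x, (w x * g x) ^ 2 ∂μ
  have hm1 : Measurable fun x => ∫⁻ y, (w y * f y) * g (x - y) ∂μ :=
    Measurable.lintegral_prod_right' (f := fun p : E × E => (w p.2 * f p.2) * g (p.1 - p.2))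
        (by fun_prop)
  have key : ∀ x, (w x * ∫⁻ y, f y * g (x - y) ∂μ) ^ 2 ≤
      K ^ 2 * 2 ^ 2 * ((∫⁻ y, (w y * f y) * g (x - y) ∂μ) ^ 2 +
        (∫⁻ y, f y * (w (x - y) * g (x - y)) ∂μ) ^ 2) := fun x => by
    have : w x * ∫⁻ y, f y * g (x - y) ∂μ ≤ K * ((∫⁻ y, (w y * f y) * g (x - y) ∂μ) +
        (∫⁻ y, f y * (w (x - y) * g (x - y)) ∂μ)) := by
      rw [← lintegral_const_mul _ (by fun_prop), ← lintegral_add_left (by fun_prop),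
        ← lintegral_const_mul _ (by fun_prop)]
      refine lintegral_mono fun y => ?_
      calc w x * (f y * g (x - y)) ≤ K * (w y + w (x - y)) * (f y * g (x - y)) := by
            gcongr; exact hwK x y
        _ = _ := by ring
    calc _ ≤ _ := pow_le_pow_left' this 2
      _ ≤ _ := by rw [mul_pow, mul_assoc]; gcongr; exact add_pow_le_two_pow_mul _ _ 2
  calc _ ≤ _ := lintegral_mono key
    _ = K ^ 2 * 2 ^ 2 * ((∫⁻ x, (∫⁻ y, (w y * f y) * g (x - y) ∂μ) ^ 2 ∂μ) +
        ∫⁻ x, (∫⁻ y, f y * (w (x - y) * g (x - y)) ∂μ) ^ 2 ∂μ) := by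
      have hm2 : Measurable fun x => ∫⁻ y, f y * (w (x - y) * g (x - y)) ∂μ :=
        Measurable.lintegral_prod_right'
          (f := fun p : E × E => f p.2 * (w (p.1 - p.2) * g (p.1 - p.2))) (by fun_prop)
      rw [lintegral_const_mul _ (by fun_prop), lintegral_add_left (by fun_prop)]
    _ ≤ K ^ 2 * 2 ^ 2 * (A * (J * B) + (J * A) * B) := by
      gcongr
      · exact (lintegral_sq_lintegral_mul_sub_le μ (hw.mul hf) hg).trans
          (mul_le_mul' le_rfl (sq_lintegral_le_weight μ hw hg hw0 hwt))
      · exact (lintegral_sq_lintegral_mul_sub_le' μ hf (hw.mul hg)).trans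
          (mul_le_mul' (sq_lintegral_le_weight μ hw hf hw0 hwt) le_rfl)
    _ = _ := by ring

end Convolution

theorem ENNReal.sq_sum_le_card_mul_sum_sq {ι : Type*} (t : Finset ι) (f : ι → ℝ≥0∞) :
    (∑ i ∈ t, f i) ^ 2 ≤ t.card * ∑ i ∈ t, f i ^ 2 := by
  have h := ENNReal.rpow_sum_le_const_mul_sum_rpow t f (p := 2) (by norm_num)
  norm_num at h
  exact h

section Fourier

open scoped FourierTransform LineDeriv SchwartzMap

variable {V : Type*} [NormedAddCommGroup V] [InnerProductSpace ℝ V] [FiniteDimensional ℝ V]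

omit [FiniteDimensional ℝ V] in
theorem ContinuousMultilinearMap.norm_le_sum_orthonormalBasis {ι G : Type*} [Fintype ι]
    [NormedAddCommGroup G] [NormedSpace ℝ G] {k : ℕ} (b : OrthonormalBasis ι ℝ V)
    (M : V [×k]→L[ℝ] G) : ‖M‖ ≤ ∑ I : Fin k → ι, ‖M fun j => b (I j)‖ := by
  classical
  refine M.opNorm_le_bound (by positivity) fun m => ?_
  have hm : m = fun j => ∑ i, inner ℝ (b i) (m j) • b i := by
    funext j; exact (b.sum_repr' (m j)).symm
  conv_lhs => rw [hm]
  rw [ContinuousMultilinearMap.map_sum, Finset.sum_mul]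
  refine (norm_sum_le _ _).trans (Finset.sum_le_sum fun I _ => ?_)
  rw [ContinuousMultilinearMap.map_smul_univ, norm_smul, mul_comm, norm_prod]
  gcongr with j
  exact (norm_inner_le_norm _ _).trans (by simp)

theorem exists_enorm_le_finrank_mul_enorm_inner [Nontrivial V] (x : V) :
    ∃ i, ‖x‖ₑ ≤ Module.finrank ℝ V * ‖inner ℝ x (stdOrthonormalBasis ℝ V i)‖ₑ := by
  have : Nonempty (Fin (Module.finrank ℝ V)) := ⟨⟨0, Module.finrank_pos⟩⟩
  obtain ⟨i, hi⟩ := Finite.exists_max fun i => ‖inner ℝ x (stdOrthonormalBasis ℝ V i)‖ₑ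
  refine ⟨i, ?_⟩
  conv_lhs => rw [← (stdOrthonormalBasis ℝ V).sum_repr' x]
  refine (enorm_sum_le _ _).trans ?_
  refine (Finset.sum_le_card_nsmul _ _ ‖inner ℝ x (stdOrthonormalBasis ℝ V i)‖ₑ
    fun j _ => ?_).trans_eq ?_
  · rw [enorm_smul, real_inner_comm]
    refine le_trans (le_of_eq ?_) (hi j)
    rw [show ‖stdOrthonormalBasis ℝ V j‖ₑ = 1 by simp [enorm_eq_nnnorm], mul_one]
  · simp

variable [MeasurableSpace V] [BorelSpace V]

theorem SchwartzMap.lintegral_enorm_sq_fourierInv (φ : 𝓢(V, ℂ)) :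
    ∫⁻ ξ, ‖𝓕⁻ φ ξ‖ₑ ^ 2 = ∫⁻ x, ‖φ x‖ₑ ^ 2 := by
  have h : ∀ f : 𝓢(V, ℂ), ∫⁻ x, ‖f x‖ₑ ^ 2 = ENNReal.ofReal (∫ x, ‖f x‖ ^ 2) := fun f => by
    rw [ofReal_integral_eq_lintegral_ofReal]
    · simp [ENNReal.ofReal_pow]
    · exact (f.memLp 2).integrable_norm_pow (by norm_num)
    · exact .of_forall fun x => by positivity
  rw [h, h, ← SchwartzMap.integral_norm_sq_fourier]
  simp

theorem SchwartzMap.enorm_fourierInv_iteratedLineDerivOp {k : ℕ} (m : Fin k → V) (φ : 𝓢(V, ℂ))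
    (ξ : V) : ‖𝓕⁻ (∂^{m} φ) ξ‖ₑ = (∏ j, ‖2 * Real.pi * inner ℝ ξ (m j)‖ₑ) * ‖𝓕⁻ φ ξ‖ₑ := by
  induction k with
  | zero => simp
  | succ k ih =>
    have hg : (fun x : V => inner ℝ x (m 0)).HasTemperateGrowth := by fun_prop
    have hc : ‖-(2 * (Real.pi : ℂ) * Complex.I)‖ₑ = ‖2 * Real.pi‖ₑ := by
      rw [← ofReal_norm, ← ofReal_norm]; simp
    rw [LineDeriv.iteratedLineDerivOp_succ_left, SchwartzMap.fourierInv_lineDerivOp_eq,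
      Fin.prod_univ_succ, smul_apply, SchwartzMap.smulLeftCLM_apply_apply hg,
      enorm_smul, hc, enorm_smul, ih]
    simp only [Fin.tail, enorm_mul]
    ring

/-- The weight `(1 + ‖ξ‖) ^ s` controlling `s` derivatives on the Fourier side. -/
noncomputable def fourierWeight (s : ℕ) (ξ : V) : ℝ≥0∞ := (1 + ‖ξ‖ₑ) ^ s

omit [InnerProductSpace ℝ V] [FiniteDimensional ℝ V] in
theorem measurable_fourierWeight (s : ℕ) : Measurable (fourierWeight s : V → ℝ≥0∞) := by
  unfold fourierWeight; fun_prop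

theorem lintegral_sq_fourierWeight_mul_le [Nontrivial V] (s : ℕ) :
    ∃ C : ℝ≥0∞, C ≠ ∞ ∧ ∀ φ : 𝓢(V, ℂ), ∫⁻ ξ, (fourierWeight s ξ * ‖𝓕⁻ φ ξ‖ₑ) ^ 2 ≤
      C * ((∫⁻ x, ‖φ x‖ₑ ^ 2) + ∫⁻ x, ‖iteratedFDeriv ℝ s φ x‖ₑ ^ 2) := by
  set d : ℝ≥0∞ := ((Module.finrank ℝ V : ℕ) : ℝ≥0∞)
  set b := stdOrthonormalBasis ℝ V
  have hd : 1 ≤ d := by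
    simp only [d, Nat.one_le_cast]; exact Module.finrank_pos
  refine ⟨(2 ^ s) ^ 2 * 2 ^ 2 * ((d ^ s) ^ 2 * d), by finiteness, fun φ => ?_⟩
  have hpt : ∀ ξ, (fourierWeight s ξ * ‖𝓕⁻ φ ξ‖ₑ) ^ 2 ≤ (2 ^ s) ^ 2 * 2 ^ 2 *
      (‖𝓕⁻ φ ξ‖ₑ ^ 2 + (d ^ s) ^ 2 * ∑ i, ‖𝓕⁻ (∂^{fun _ : Fin s => b i} φ) ξ‖ₑ ^ 2) := fun ξ => by
    obtain ⟨i, hi⟩ := exists_enorm_le_finrank_mul_enorm_inner ξ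
    have h1 : ‖ξ‖ₑ ^ s * ‖𝓕⁻ φ ξ‖ₑ ≤ d ^ s * ‖𝓕⁻ (∂^{fun _ : Fin s => b i} φ) ξ‖ₑ := by
      rw [SchwartzMap.enorm_fourierInv_iteratedLineDerivOp, Finset.prod_const, Finset.card_univ,
        Fintype.card_fin, ← mul_assoc, ← mul_pow]
      gcongr
      refine hi.trans ?_
      gcongr
      rw [enorm_mul]
      refine le_mul_of_one_le_left' ?_
      rw [enorm_eq_nnnorm, ← ENNReal.coe_one, ENNReal.coe_le_coe, ← NNReal.coe_le_coe]
      simp [abs_of_pos Real.pi_pos]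
      linarith [Real.pi_gt_three]
    calc (fourierWeight s ξ * ‖𝓕⁻ φ ξ‖ₑ) ^ 2
        ≤ (2 ^ s * (1 ^ s + ‖ξ‖ₑ ^ s) * ‖𝓕⁻ φ ξ‖ₑ) ^ 2 := by
          gcongr; exact add_pow_le_two_pow_mul _ _ _
      _ = (2 ^ s) ^ 2 * (‖𝓕⁻ φ ξ‖ₑ + ‖ξ‖ₑ ^ s * ‖𝓕⁻ φ ξ‖ₑ) ^ 2 := by ring
      _ ≤ (2 ^ s) ^ 2 * (2 ^ 2 * (‖𝓕⁻ φ ξ‖ₑ ^ 2 + (‖ξ‖ₑ ^ s * ‖𝓕⁻ φ ξ‖ₑ) ^ 2)) := by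
          gcongr; exact add_pow_le_two_pow_mul _ _ _
      _ ≤ (2 ^ s) ^ 2 * (2 ^ 2 * (‖𝓕⁻ φ ξ‖ₑ ^ 2 +
          (d ^ s * ‖𝓕⁻ (∂^{fun _ : Fin s => b i} φ) ξ‖ₑ) ^ 2)) := by gcongr
      _ ≤ _ := by
          rw [mul_assoc, mul_pow]
          gcongr
          exact Finset.single_le_sum (f := fun i => ‖𝓕⁻ (∂^{fun _ : Fin s => b i} φ) ξ‖ₑ ^ 2)
            (fun _ _ => zero_le) (Finset.mem_univ i)
  have hm : ∀ f : 𝓢(V, ℂ), Measurable fun ξ => ‖f ξ‖ₑ ^ 2 := fun f =>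
    (f.continuous.enorm.measurable).pow_const 2
  calc _ ≤ _ := lintegral_mono hpt
    _ = (2 ^ s) ^ 2 * 2 ^ 2 * ((∫⁻ x, ‖φ x‖ₑ ^ 2) +
        (d ^ s) ^ 2 * ∑ i, ∫⁻ x, ‖(∂^{fun _ : Fin s => b i} φ) x‖ₑ ^ 2) := by
      rw [lintegral_const_mul _ (by have := hm; fun_prop), lintegral_add_left (hm _),
        lintegral_const_mul _ (by have := hm; fun_prop), lintegral_finsetSum _ (fun i _ => hm _)]
      simp only [SchwartzMap.lintegral_enorm_sq_fourierInv]
    _ ≤ (2 ^ s) ^ 2 * 2 ^ 2 * ((∫⁻ x, ‖φ x‖ₑ ^ 2) +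
        (d ^ s) ^ 2 * ∑ i : Fin (Module.finrank ℝ V), ∫⁻ x, ‖iteratedFDeriv ℝ s φ x‖ₑ ^ 2) := by
      gcongr with i _ x
      rw [SchwartzMap.iteratedLineDerivOp_eq_iteratedFDeriv, enorm_le_iff_norm_le]
      exact ((iteratedFDeriv ℝ s φ x).le_opNorm _).trans (by simp)
    _ ≤ _ := by
      rw [Finset.sum_const, Finset.card_univ, Fintype.card_fin, nsmul_eq_mul, mul_assoc, mul_assoc,
        mul_assoc]
      gcongr
      rw [← mul_assoc, mul_add]
      gcongr
      exact le_mul_of_one_le_left' (one_le_mul (one_le_pow₀ (one_le_pow₀ hd)) hd)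

theorem lintegral_enorm_sq_iteratedFDeriv_le {k s : ℕ} (hk : k ≤ s) :
    ∃ C : ℝ≥0∞, C ≠ ∞ ∧ ∀ φ : 𝓢(V, ℂ), ∫⁻ x, ‖iteratedFDeriv ℝ k φ x‖ₑ ^ 2 ≤
      C * ∫⁻ ξ, (fourierWeight s ξ * ‖𝓕⁻ φ ξ‖ₑ) ^ 2 := by
  set d := Module.finrank ℝ V
  set b := stdOrthonormalBasis ℝ V
  set N : ℝ≥0∞ := ((Finset.univ : Finset (Fin k → Fin d)).card : ℝ≥0∞)
  set c : ℝ≥0∞ := ‖2 * Real.pi‖ₑ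
  refine ⟨N * (N * (c ^ k) ^ 2), by finiteness, fun φ => ?_⟩
  have hm : ∀ f : 𝓢(V, ℂ), Measurable fun ξ => ‖f ξ‖ₑ ^ 2 := fun f =>
    (f.continuous.enorm.measurable).pow_const 2
  have hpt : ∀ x, ‖iteratedFDeriv ℝ k φ x‖ₑ ^ 2 ≤
      N * ∑ I : Fin k → Fin d, ‖(∂^{fun j => b (I j)} φ) x‖ₑ ^ 2 := fun x => by
    refine le_trans ?_ (ENNReal.sq_sum_le_card_mul_sum_sq _ _)
    gcongr
    simp only [SchwartzMap.iteratedLineDerivOp_eq_iteratedFDeriv, ← ofReal_norm]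
    rw [← ENNReal.ofReal_sum_of_nonneg fun _ _ => norm_nonneg _]
    exact ENNReal.ofReal_le_ofReal
      ((iteratedFDeriv ℝ k φ x).norm_le_sum_orthonormalBasis b)
  have hI : ∀ I : Fin k → Fin d, ∫⁻ x, ‖(∂^{fun j => b (I j)} φ) x‖ₑ ^ 2 ≤
      (c ^ k) ^ 2 * ∫⁻ ξ, (fourierWeight s ξ * ‖𝓕⁻ φ ξ‖ₑ) ^ 2 := fun I => by
    rw [← SchwartzMap.lintegral_enorm_sq_fourierInv, ← lintegral_const_mul' _ _ (by finiteness)]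
    refine lintegral_mono fun ξ => ?_
    rw [SchwartzMap.enorm_fourierInv_iteratedLineDerivOp, ← mul_pow, ← mul_assoc]
    gcongr
    calc ∏ j, ‖2 * Real.pi * inner ℝ ξ (b (I j))‖ₑ ≤ ∏ j : Fin k, c * (1 + ‖ξ‖ₑ) := by
          gcongr with j
          rw [enorm_mul]
          gcongr
          refine le_trans ?_ le_add_self
          rw [enorm_le_iff_norm_le]
          exact (norm_inner_le_norm _ _).trans (by simp)
      _ = c ^ k * (1 + ‖ξ‖ₑ) ^ k := by simp [mul_pow]
      _ ≤ _ := by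
          unfold fourierWeight
          gcongr
          exact le_self_add
  calc _ ≤ _ := lintegral_mono hpt
    _ = N * ∑ I : Fin k → Fin d, ∫⁻ x, ‖(∂^{fun j => b (I j)} φ) x‖ₑ ^ 2 := by
      rw [lintegral_const_mul' _ _ (by finiteness), lintegral_finsetSum _ (fun i _ => hm _)]
    _ ≤ N * ∑ I : Fin k → Fin d, (c ^ k) ^ 2 * ∫⁻ ξ, (fourierWeight s ξ * ‖𝓕⁻ φ ξ‖ₑ) ^ 2 := by
      gcongr with I; exact hI I
    _ = _ := by rw [Finset.sum_const, nsmul_eq_mul]; ring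

theorem SchwartzMap.enorm_fourierInv_pairing_mul_le (φ ψ : 𝓢(V, ℂ)) (ξ : V) :
    ‖𝓕⁻ (SchwartzMap.pairing (ContinuousLinearMap.mul ℂ ℂ) φ ψ) ξ‖ₑ ≤
      ∫⁻ η, ‖𝓕⁻ φ η‖ₑ * ‖𝓕⁻ ψ (ξ - η)‖ₑ := by
  have h := SchwartzMap.convolution_apply (ContinuousLinearMap.mul ℂ ℂ) (𝓕⁻ φ) (𝓕⁻ ψ) ξ
  have h2 : SchwartzMap.convolution (ContinuousLinearMap.mul ℂ ℂ) (𝓕⁻ φ) (𝓕⁻ ψ) =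
      𝓕⁻ (SchwartzMap.pairing (ContinuousLinearMap.mul ℂ ℂ) φ ψ) := by
    simp [SchwartzMap.convolution]
  rw [← h2, h]
  unfold MeasureTheory.convolution
  refine (enorm_integral_le_lintegral_enorm _).trans_eq ?_
  simp [enorm_mul]

theorem lintegral_inv_fourierWeight_sq_ne_top {s : ℕ} (hs : Module.finrank ℝ V < 2 * s) :
    ∫⁻ ξ : V, (fourierWeight s ξ)⁻¹ ^ 2 ≠ ∞ := by
  have h := finite_integral_one_add_norm (E := V) (μ := volume) (r := ((2 * s : ℕ) : ℝ))
    (by exact_mod_cast hs)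
  refine ne_of_lt (lt_of_le_of_lt (le_of_eq (lintegral_congr fun ξ => ?_)) h)
  rw [fourierWeight, Real.rpow_neg (by positivity), ENNReal.ofReal_inv_of_pos (by positivity),
    Real.rpow_natCast, ENNReal.ofReal_pow (by positivity), ENNReal.ofReal_add (by simp) (by simp),
    ofReal_norm, ENNReal.ofReal_one, ENNReal.inv_pow, pow_mul', ENNReal.inv_pow,
    ENNReal.inv_pow]

theorem SchwartzMap.exists_lintegral_iteratedFDeriv_pairing_mul_le [Nontrivial V] {k s : ℕ}
    (hs : Module.finrank ℝ V < 2 * s) (hk : k ≤ s) :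
    ∃ C : ℝ≥0∞, C ≠ ∞ ∧ ∀ φ ψ : 𝓢(V, ℂ),
      ∫⁻ x, ‖iteratedFDeriv ℝ k (SchwartzMap.pairing (ContinuousLinearMap.mul ℂ ℂ) φ ψ) x‖ₑ ^ 2 ≤
        C * ((∫⁻ x, ‖φ x‖ₑ ^ 2) + ∫⁻ x, ‖iteratedFDeriv ℝ s φ x‖ₑ ^ 2) *
          ((∫⁻ x, ‖ψ x‖ₑ ^ 2) + ∫⁻ x, ‖iteratedFDeriv ℝ s ψ x‖ₑ ^ 2) := by
  obtain ⟨C₁, hC₁, h₁⟩ := lintegral_sq_fourierWeight_mul_le (V := V) s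
  obtain ⟨C₂, hC₂, h₂⟩ := lintegral_enorm_sq_iteratedFDeriv_le (V := V) hk
  set J := ∫⁻ ξ : V, (fourierWeight s ξ)⁻¹ ^ 2
  have hJ : J ≠ ∞ := lintegral_inv_fourierWeight_sq_ne_top hs
  refine ⟨C₂ * ((2 ^ s) ^ 2 * 8 * J * C₁ * C₁), by finiteness, fun φ ψ => ?_⟩
  have hw : ∀ x y : V, fourierWeight s x ≤ 2 ^ s * (fourierWeight s y + fourierWeight s (x - y)) :=
    fun x y => by
      refine le_trans (pow_le_pow_left' ?_ s) (add_pow_le_two_pow_mul _ _ s)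
      calc 1 + ‖x‖ₑ = 1 + ‖y + (x - y)‖ₑ := by simp
        _ ≤ 1 + (‖y‖ₑ + ‖x - y‖ₑ) := by gcongr; exact enorm_add_le _ _
        _ ≤ (1 + ‖y‖ₑ) + (1 + ‖x - y‖ₑ) := by
          rw [← add_assoc]; gcongr; exact le_add_self
  have key := lintegral_sq_weight_mul_conv_le (volume : Measure V) (measurable_fourierWeight s)
    (fun x => by simp [fourierWeight]) (fun x => by unfold fourierWeight; finiteness) hw
    (𝓕⁻ φ).continuous.enorm.measurable (𝓕⁻ ψ).continuous.enorm.measurable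
  refine (h₂ _).trans ?_
  calc _ ≤ C₂ * ∫⁻ ξ, (fourierWeight s ξ * ∫⁻ η, ‖𝓕⁻ φ η‖ₑ * ‖𝓕⁻ ψ (ξ - η)‖ₑ) ^ 2 := by
        gcongr with ξ
        exact SchwartzMap.enorm_fourierInv_pairing_mul_le φ ψ ξ
    _ ≤ _ := mul_le_mul' le_rfl key
    _ ≤ _ := mul_le_mul' le_rfl (mul_le_mul' (mul_le_mul' le_rfl (h₁ φ)) (h₁ ψ))
    _ = _ := by ring

end Fourier

section Localization

open scoped ContDiff SchwartzMap Manifold Topology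

variable {V : Type*} [NormedAddCommGroup V] [InnerProductSpace ℝ V]

/-- The sum of the squared norms of the derivatives of `u` up to order `s`. -/
noncomputable def jetNormSq (s : ℕ) (u : V → ℝ) (x : V) : ℝ≥0∞ :=
  ∑ k ∈ Finset.range (s + 1), ‖iteratedFDeriv ℝ k u x‖ₑ ^ 2

theorem enorm_sq_le_jetNormSq {k s : ℕ} (hk : k ≤ s) (u : V → ℝ) (x : V) :
    ‖iteratedFDeriv ℝ k u x‖ₑ ^ 2 ≤ jetNormSq s u x :=
  Finset.single_le_sum (f := fun k => ‖iteratedFDeriv ℝ k u x‖ₑ ^ 2) (fun _ _ => zero_le)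
    (by simp; lia)

theorem ContDiff.continuous_enorm_iteratedFDeriv_sq {u : V → ℝ} (hu : ContDiff ℝ ∞ u) (k : ℕ) :
    Continuous fun x => ‖iteratedFDeriv ℝ k u x‖ₑ ^ 2 := by
  have := (hu.continuous_iteratedFDeriv (m := k) (by exact_mod_cast le_top)).enorm
  fun_prop

theorem exists_jetNormSq_cutoff_mul_le {χ : V → ℝ} (hχ : ContDiff ℝ ∞ χ)
    (hχc : HasCompactSupport χ) (s : ℕ) :
    ∃ C : ℝ≥0∞, C ≠ ⊤ ∧ ∀ u : V → ℝ, ContDiff ℝ ∞ u → ∀ x,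
      jetNormSq s (fun y => χ y * u y) x ≤
        (tsupport χ).indicator (fun y => C * jetNormSq s u y) x := by
  have hb : ∀ k, ∃ M : ℝ, ∀ x, ‖iteratedFDeriv ℝ k χ x‖ ≤ M := fun k => by
    obtain ⟨M, hM⟩ := (hχc.iteratedFDeriv (𝕜 := ℝ) k).exists_bound_of_continuous
      (hχ.continuous_iteratedFDeriv (m := k) (by exact_mod_cast le_top))
    exact ⟨M, hM⟩
  choose M hM using hb
  set B : ℝ≥0∞ := ∑ k ∈ Finset.range (s + 1), ∑ i ∈ Finset.range (k + 1),
    ENNReal.ofReal (k.choose i * M i)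
  have hB : B ≠ ⊤ := ENNReal.sum_ne_top.2 fun _ _ =>
    ENNReal.sum_ne_top.2 fun _ _ => ENNReal.ofReal_ne_top
  refine ⟨(s + 1) * (B ^ 2 * (s + 1)), by finiteness, fun u hu x => ?_⟩
  by_cases hx : x ∈ tsupport χ
  · rw [Set.indicator_of_mem hx]
    have hk : ∀ k ∈ Finset.range (s + 1), ‖iteratedFDeriv ℝ k (fun y => χ y * u y) x‖ₑ ^ 2 ≤
        B ^ 2 * (s + 1) * jetNormSq s u x := fun k hk => by
      have hks : k ≤ s := by simp at hk; lia
      have h1 : ‖iteratedFDeriv ℝ k (fun y => χ y * u y) x‖ₑ ≤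
          B * ∑ j ∈ Finset.range (s + 1), ‖iteratedFDeriv ℝ j u x‖ₑ := by
        have h := norm_iteratedFDeriv_mul_le (n := k) hχ hu x (by exact_mod_cast le_top)
        calc _ ≤ ENNReal.ofReal (∑ i ∈ Finset.range (k + 1), (k.choose i : ℝ) *
              ‖iteratedFDeriv ℝ i χ x‖ * ‖iteratedFDeriv ℝ (k - i) u x‖) := by
              rw [← ofReal_norm]; exact ENNReal.ofReal_le_ofReal h
          _ = ∑ i ∈ Finset.range (k + 1), ENNReal.ofReal ((k.choose i : ℝ) *
              ‖iteratedFDeriv ℝ i χ x‖) * ‖iteratedFDeriv ℝ (k - i) u x‖ₑ := by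
              rw [ENNReal.ofReal_sum_of_nonneg fun _ _ => by positivity]
              refine Finset.sum_congr rfl fun i _ => ?_
              rw [ENNReal.ofReal_mul (by positivity), ofReal_norm]
          _ ≤ ∑ i ∈ Finset.range (k + 1), ENNReal.ofReal (k.choose i * M i) *
              ∑ j ∈ Finset.range (s + 1), ‖iteratedFDeriv ℝ j u x‖ₑ := by
              gcongr with i hi
              · exact hM i x
              · exact Finset.single_le_sum (f := fun j => ‖iteratedFDeriv ℝ j u x‖ₑ)
                  (fun _ _ => zero_le) (by simp; lia)
          _ ≤ _ := by
              rw [← Finset.sum_mul]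
              gcongr
              exact Finset.single_le_sum (f := fun k => ∑ i ∈ Finset.range (k + 1),
                ENNReal.ofReal (k.choose i * M i)) (fun _ _ => zero_le) hk
      calc _ ≤ _ := pow_le_pow_left' h1 2
        _ ≤ B ^ 2 * ((Finset.range (s + 1)).card * jetNormSq s u x) := by
          rw [mul_pow]; gcongr; exact ENNReal.sq_sum_le_card_mul_sum_sq _ _
        _ = _ := by simp [mul_assoc]
    refine (Finset.sum_le_card_nsmul _ _ _ hk).trans_eq ?_
    simp [mul_assoc]
  · rw [Set.indicator_of_notMem hx]
    have h0 : (fun y => χ y * u y) =ᶠ[𝓝 x] fun _ => 0 := by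
      filter_upwards [notMem_tsupport_iff_eventuallyEq.1 hx] with y hy
      simp [hy]
    have : ∀ k, iteratedFDeriv ℝ k (fun y => χ y * u y) x = 0 := fun k => by
      rw [(h0.iteratedFDeriv ℝ k).eq_of_nhds]; simp
    exact (Finset.sum_eq_zero fun k _ => by rw [this k, ← ofReal_norm, norm_zero]; simp).le

variable [FiniteDimensional ℝ V] [MeasurableSpace V] [BorelSpace V]

theorem exists_lintegral_jetNormSq_mul_le_of_hasCompactSupport [Nontrivial V] {s : ℕ}
    (hs : Module.finrank ℝ V < 2 * s) :
    ∃ C : ℝ≥0∞, C ≠ ⊤ ∧ ∀ u v : V → ℝ, ContDiff ℝ ∞ u → ContDiff ℝ ∞ v →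
      HasCompactSupport u → HasCompactSupport v →
      ∫⁻ x, jetNormSq s (fun y => u y * v y) x ≤
        C * (∫⁻ x, jetNormSq s u x) * ∫⁻ x, jetNormSq s v x := by
  have h : ∀ k ∈ Finset.range (s + 1), _ := fun k hk =>
    SchwartzMap.exists_lintegral_iteratedFDeriv_pairing_mul_le (V := V) (k := k) hs
      (by simp at hk; lia)
  choose! C hC h using h
  refine ⟨∑ k ∈ Finset.range (s + 1), C k * 2 * 2,
    by simp only [ne_eq, ENNReal.sum_eq_top, not_exists, not_and]
       intro k hk; have := hC k hk; finiteness, fun u v hu hv huc hvc => ?_⟩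
  have hc : ∀ w : V → ℝ, ContDiff ℝ ∞ w → ∀ k x,
      ‖iteratedFDeriv ℝ k (fun y => (w y : ℂ)) x‖ₑ = ‖iteratedFDeriv ℝ k w x‖ₑ := fun w hw k x => by
    rw [← ofReal_norm, ← ofReal_norm]
    exact congrArg _ (Complex.ofRealLI.norm_iteratedFDeriv_comp_left (i := k) (n := k)
      ((hw.of_le (by exact_mod_cast le_top)).contDiffAt) le_rfl)
  have hS : ∀ w : V → ℝ, ∀ hw : ContDiff ℝ ∞ w, ∀ hwc : HasCompactSupport w,
      ∃ φ : 𝓢(V, ℂ), (φ : V → ℂ) = fun y => (w y : ℂ) := fun w hw hwc =>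
    ⟨(hwc.comp_left (g := fun t : ℝ => (t : ℂ)) (by simp)).toSchwartzMap
      (Complex.ofRealCLM.contDiff.comp hw), rfl⟩
  have hJ : ∀ w : V → ℝ, ContDiff ℝ ∞ w → ∀ φ : 𝓢(V, ℂ), (φ : V → ℂ) = (fun y => (w y : ℂ)) →
      (∫⁻ x, ‖φ x‖ₑ ^ 2) + ∫⁻ x, ‖iteratedFDeriv ℝ s φ x‖ₑ ^ 2 ≤
        2 * ∫⁻ x, jetNormSq s w x := fun w hw φ hφ => by
    rw [two_mul]
    gcongr with x x
    · refine le_trans (le_of_eq ?_) (enorm_sq_le_jetNormSq (Nat.zero_le s) w x)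
      rw [hφ, ← hc w hw, ← ofReal_norm, ← ofReal_norm, norm_iteratedFDeriv_zero]
    · rw [hφ, hc w hw]
      exact enorm_sq_le_jetNormSq le_rfl w x
  obtain ⟨φ, hφ⟩ := hS u hu huc
  obtain ⟨ψ, hψ⟩ := hS v hv hvc
  have hp : (SchwartzMap.pairing (ContinuousLinearMap.mul ℂ ℂ) φ ψ : V → ℂ) =
      fun y => ((u y * v y : ℝ) : ℂ) := by
    funext y
    simp [SchwartzMap.pairing_apply_apply, hφ, hψ]
  unfold jetNormSq
  rw [lintegral_finsetSum _ fun k _ =>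
    ((hu.mul hv).continuous_enorm_iteratedFDeriv_sq k).measurable, Finset.sum_mul, Finset.sum_mul]
  refine Finset.sum_le_sum fun k hk => ?_
  have := h k hk φ ψ
  simp only [hp, hc (fun y => u y * v y) (hu.mul hv)] at this
  calc _ ≤ _ := this
    _ ≤ _ := mul_le_mul' (mul_le_mul' le_rfl (hJ u hu φ hφ)) (hJ v hv ψ hψ)
    _ = _ := by unfold jetNormSq; ring

theorem exists_setLIntegral_jetNormSq_mul_le [Nontrivial V] {s : ℕ}
    (hs : Module.finrank ℝ V < 2 * s) {K O : Set V} (hK : IsCompact K) (hO : IsOpen O)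
    (hKO : K ⊆ O) :
    ∃ C : ℝ≥0∞, C ≠ ⊤ ∧ ∀ u v : V → ℝ, ContDiff ℝ ∞ u → ContDiff ℝ ∞ v →
      ∫⁻ x in K, jetNormSq s (fun y => u y * v y) x ≤
        C * (∫⁻ x in O, jetNormSq s u x) * ∫⁻ x in O, jetNormSq s v x := by
  obtain ⟨T, hT, hKT, hTO⟩ := exists_compact_between hK hO hKO
  obtain ⟨χ, hχ1, hχ0, -⟩ := exists_contMDiffMap_one_nhds_of_subset_interior (n := (⊤ : ℕ∞))
    𝓘(ℝ, V) hK.isClosed hKT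
  have hχ : ContDiff ℝ ∞ χ := χ.contMDiff.contDiff
  have hsupp : tsupport χ ⊆ T :=
    closure_minimal (fun x hx => by_contra fun h => hx (hχ0 x h)) hT.isClosed
  have hχc : HasCompactSupport χ := hT.of_isClosed_subset (isClosed_tsupport _) hsupp
  obtain ⟨C₁, hC₁, h₁⟩ := exists_lintegral_jetNormSq_mul_le_of_hasCompactSupport (V := V) hs
  obtain ⟨C₂, hC₂, h₂⟩ := exists_jetNormSq_cutoff_mul_le hχ hχc s
  have hloc : ∀ u : V → ℝ, ContDiff ℝ ∞ u →
      ∫⁻ x, jetNormSq s (fun y => χ y * u y) x ≤ C₂ * ∫⁻ x in O, jetNormSq s u x := fun u hu => by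
    calc _ ≤ _ := lintegral_mono (h₂ u hu)
      _ = ∫⁻ x in tsupport χ, C₂ * jetNormSq s u x :=
        lintegral_indicator (isClosed_tsupport _).measurableSet _
      _ ≤ ∫⁻ x in O, C₂ * jetNormSq s u x := lintegral_mono_set (hsupp.trans hTO)
      _ = _ := lintegral_const_mul' _ _ hC₂
  refine ⟨C₁ * C₂ * C₂, by finiteness, fun u v hu hv => ?_⟩
  have heq : ∀ x ∈ K, jetNormSq s (fun y => u y * v y) x =
      jetNormSq s (fun y => (χ y * u y) * (χ y * v y)) x := fun x hx => by
    have : (fun y => u y * v y) =ᶠ[𝓝 x] fun y => (χ y * u y) * (χ y * v y) := by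
      filter_upwards [hχ1.filter_mono (nhds_le_nhdsSet hx)] with y hy
      simp [hy]
    unfold jetNormSq
    simp only [(this.iteratedFDeriv ℝ _).eq_of_nhds]
  calc _ = ∫⁻ x in K, jetNormSq s (fun y => (χ y * u y) * (χ y * v y)) x :=
        setLIntegral_congr_fun hK.measurableSet heq
    _ ≤ _ := setLIntegral_le_lintegral _ _
    _ ≤ _ := h₁ _ _ (hχ.mul hu) (hχ.mul hv) hχc.mul_right hχc.mul_right
    _ ≤ _ := mul_le_mul' (mul_le_mul' le_rfl (hloc u hu)) (hloc v hv)
    _ = _ := by ring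

end Localization

section Weighted

open scoped ContDiff

theorem Real.rpow_le_rpow_abs_mul_rpow {a b c : ℝ} (ha : 0 < a) (hb : 0 < b) (hc : 1 ≤ c)
    (hab : a ≤ c * b) (hba : b ≤ c * a) {p q : ℝ} (hpq : |p| ≤ q) :
    a ^ p ≤ c ^ q * b ^ p := by
  rw [← div_le_iff₀ (by positivity), ← Real.div_rpow ha.le hb.le]
  refine le_trans ?_ (Real.rpow_le_rpow_of_exponent_le hc hpq)
  rcases le_total 0 p with hp | hp
  · rw [abs_of_nonneg hp]
    exact Real.rpow_le_rpow (by positivity) ((div_le_iff₀ hb).2 hab) hp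
  · rw [abs_of_nonpos hp, ← neg_neg p, Real.rpow_neg (by positivity), neg_neg,
      ← Real.inv_rpow (by positivity), inv_div]
    exact Real.rpow_le_rpow (by positivity) ((div_le_iff₀ ha).2 hba) (by linarith)

variable {V : Type*} [NormedAddCommGroup V] [InnerProductSpace ℝ V]

/-- The density of the square of the weighted Sobolev norm. -/
noncomputable def weightedJetNormSq (s : ℕ) (δ : ℝ) (u : V → ℝ) (x : V) : ℝ≥0∞ :=
  ∑ k ∈ Finset.range (s + 1),
    ENNReal.ofReal ((1 + ‖x‖ ^ 2) ^ (δ + (k : ℝ))) * ‖iteratedFDeriv ℝ k u x‖ₑ ^ 2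

theorem ofReal_mul_jetNormSq_comp_smul {u : V → ℝ} (hu : ContDiff ℝ ∞ u) (s : ℕ) (δ : ℝ) {R : ℝ}
    (hR : 0 < R) (y : V) :
    ENNReal.ofReal ((R ^ 2) ^ δ) * jetNormSq s (fun z => u (R • z)) y =
      ∑ k ∈ Finset.range (s + 1),
        ENNReal.ofReal ((R ^ 2) ^ (δ + (k : ℝ))) * ‖iteratedFDeriv ℝ k u (R • y)‖ₑ ^ 2 := by
  rw [jetNormSq, Finset.mul_sum]
  refine Finset.sum_congr rfl fun k _ => ?_
  rw [iteratedFDeriv_comp_const_smul R (hu.of_le (by exact_mod_cast le_top)),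
    Real.rpow_add (by positivity), ENNReal.ofReal_mul (by positivity), mul_assoc]
  congr 1
  rw [← ofReal_norm, ← ofReal_norm, norm_smul, ← ENNReal.ofReal_pow (by positivity),
    ← ENNReal.ofReal_pow (by positivity), ← ENNReal.ofReal_mul (by positivity), mul_pow,
    Real.rpow_natCast, norm_pow, Real.norm_of_nonneg hR.le, pow_right_comm]

theorem abs_add_natCast_le {k s : ℕ} (hk : k ∈ Finset.range (s + 1)) (δ : ℝ) :
    |δ + (k : ℝ)| ≤ |δ| + s := by
  have : (k : ℝ) ≤ s := by exact_mod_cast (by simp at hk; lia : k ≤ s)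
  exact (abs_add_le _ _).trans (by simpa using this)

theorem weightedJetNormSq_smul_le {u : V → ℝ} (hu : ContDiff ℝ ∞ u) (s : ℕ) (δ : ℝ) {R c : ℝ}
    (hR : 0 < R) (hc : 1 ≤ c) {y : V} (h₁ : 1 + ‖R • y‖ ^ 2 ≤ c * R ^ 2)
    (h₂ : R ^ 2 ≤ c * (1 + ‖R • y‖ ^ 2)) :
    weightedJetNormSq s δ u (R • y) ≤ ENNReal.ofReal (c ^ (|δ| + s)) *
      (ENNReal.ofReal ((R ^ 2) ^ δ) * jetNormSq s (fun z => u (R • z)) y) := by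
  rw [ofReal_mul_jetNormSq_comp_smul hu s δ hR, weightedJetNormSq, Finset.mul_sum]
  refine Finset.sum_le_sum fun k hk => ?_
  rw [← mul_assoc, ← ENNReal.ofReal_mul (by positivity)]
  gcongr
  exact Real.rpow_le_rpow_abs_mul_rpow (by positivity) (by positivity) hc h₁ h₂
    (abs_add_natCast_le hk δ)

theorem ofReal_mul_jetNormSq_comp_smul_le {u : V → ℝ} (hu : ContDiff ℝ ∞ u) (s : ℕ) (δ : ℝ)
    {R c : ℝ} (hR : 0 < R) (hc : 1 ≤ c) {y : V} (h₁ : 1 + ‖R • y‖ ^ 2 ≤ c * R ^ 2)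
    (h₂ : R ^ 2 ≤ c * (1 + ‖R • y‖ ^ 2)) :
    ENNReal.ofReal ((R ^ 2) ^ δ) * jetNormSq s (fun z => u (R • z)) y ≤
      ENNReal.ofReal (c ^ (|δ| + s)) * weightedJetNormSq s δ u (R • y) := by
  rw [ofReal_mul_jetNormSq_comp_smul hu s δ hR, weightedJetNormSq, Finset.mul_sum]
  refine Finset.sum_le_sum fun k hk => ?_
  rw [← mul_assoc, ← ENNReal.ofReal_mul (by positivity)]
  gcongr
  exact Real.rpow_le_rpow_abs_mul_rpow (by positivity) (by positivity) hc h₂ h₁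
    (abs_add_natCast_le hk δ)

variable [FiniteDimensional ℝ V] [MeasurableSpace V] [BorelSpace V]

theorem lintegral_comp_smul_of_pos (f : V → ℝ≥0∞) {R : ℝ} (hR : 0 < R) :
    ∫⁻ x, f (R • x) = ENNReal.ofReal ((R ^ Module.finrank ℝ V)⁻¹) * ∫⁻ x, f x := by
  have h := lintegral_map_equiv (μ := (volume : Measure V)) f
    (Homeomorph.smulOfNeZero R hR.ne').toMeasurableEquiv
  have hm : Measure.map (Homeomorph.smulOfNeZero (α := V) R hR.ne').toMeasurableEquiv volume =
      ENNReal.ofReal |(R ^ Module.finrank ℝ V)⁻¹| • volume :=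
    Measure.map_addHaar_smul volume hR.ne'
  rw [hm, lintegral_smul_measure, abs_of_nonneg (by positivity)] at h
  exact h.symm

theorem exists_setLIntegral_weightedJetNormSq_mul_le [Nontrivial V] {s : ℕ}
    (hs : Module.finrank ℝ V < 2 * s) (δ : ℝ) {c : ℝ} (hc : 1 ≤ c) {K O : Set V}
    (hK : IsCompact K) (hO : IsOpen O) (hKO : K ⊆ O) :
    ∃ C : ℝ≥0∞, C ≠ ⊤ ∧ ∀ (R : ℝ) (S : Set V), 0 < R → MeasurableSet S →
      (∀ y, R • y ∈ S → y ∈ K) →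
      (∀ y ∈ O, 1 + ‖R • y‖ ^ 2 ≤ c * R ^ 2 ∧ R ^ 2 ≤ c * (1 + ‖R • y‖ ^ 2)) →
      ∀ f g : V → ℝ, ContDiff ℝ ∞ f → ContDiff ℝ ∞ g →
      ∫⁻ x in S, weightedJetNormSq s δ (fun y => f y * g y) x ≤
        C * ENNReal.ofReal ((R ^ 2) ^ (-δ) * (R ^ Module.finrank ℝ V)⁻¹) *
          (∫⁻ x, weightedJetNormSq s δ f x) * ∫⁻ x, weightedJetNormSq s δ g x := by
  obtain ⟨C, hC, h⟩ := exists_setLIntegral_jetNormSq_mul_le hs hK hO hKO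
  set A := ENNReal.ofReal (c ^ (|δ| + s))
  refine ⟨A ^ 3 * C, by finiteness, fun R S hR hS hSK hcmp f g hf hg => ?_⟩
  set W := ENNReal.ofReal ((R ^ 2) ^ δ)
  set W' := ENNReal.ofReal ((R ^ 2) ^ (-δ))
  set D := ENNReal.ofReal (R ^ Module.finrank ℝ V)
  set D' := ENNReal.ofReal ((R ^ Module.finrank ℝ V)⁻¹)
  have hW : W' * W = 1 := by
    rw [← ENNReal.ofReal_mul (by positivity), ← Real.rpow_add (by positivity)]; simp
  have hD : D * D' = 1 := by
    rw [← ENNReal.ofReal_mul (by positivity), mul_inv_cancel₀ (by positivity)]; simp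
  have hR' : ContDiff ℝ ∞ fun z : V => R • z := contDiff_const_smul R
  have hO' : ∀ u : V → ℝ, ContDiff ℝ ∞ u →
      W * ∫⁻ y in O, jetNormSq s (fun z => u (R • z)) y ≤
        A * (D' * ∫⁻ x, weightedJetNormSq s δ u x) := fun u hu => by
    rw [← lintegral_const_mul' _ _ ENNReal.ofReal_ne_top, ← lintegral_comp_smul_of_pos _ hR,
      ← lintegral_const_mul' _ _ ENNReal.ofReal_ne_top]
    refine (setLIntegral_mono' hO.measurableSet fun y hy => ?_).trans (setLIntegral_le_lintegral _ _)
    exact ofReal_mul_jetNormSq_comp_smul_le hu s δ hR hc (hcmp y hy).1 (hcmp y hy).2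
  have hS' : D' * ∫⁻ x in S, weightedJetNormSq s δ (fun y => f y * g y) x ≤
      A * (W * ∫⁻ y in K, jetNormSq s (fun z => f (R • z) * g (R • z)) y) := by
    rw [← lintegral_indicator hS, ← lintegral_comp_smul_of_pos _ hR,
      ← lintegral_const_mul' _ _ ENNReal.ofReal_ne_top,
      ← lintegral_const_mul' _ _ ENNReal.ofReal_ne_top, ← lintegral_indicator hK.measurableSet]
    refine lintegral_mono fun y => ?_
    by_cases hy : R • y ∈ S
    · rw [Set.indicator_of_mem hy, Set.indicator_of_mem (hSK y hy)]
      have := hcmp y (hKO (hSK y hy))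
      exact weightedJetNormSq_smul_le (hf.mul hg) s δ hR hc this.1 this.2
    · rw [Set.indicator_of_notMem hy]; exact zero_le
  set I := ∫⁻ x, weightedJetNormSq s δ f x
  set J := ∫⁻ x, weightedJetNormSq s δ g x
  calc ∫⁻ x in S, weightedJetNormSq s δ (fun y => f y * g y) x
      = D * (D' * ∫⁻ x in S, weightedJetNormSq s δ (fun y => f y * g y) x) := by
        rw [← mul_assoc, hD, one_mul]
    _ ≤ D * (A * (W * (C * (∫⁻ y in O, jetNormSq s (fun z => f (R • z)) y) *
          ∫⁻ y in O, jetNormSq s (fun z => g (R • z)) y))) := by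
        refine mul_le_mul' le_rfl (hS'.trans ?_)
        gcongr
        exact h _ _ (hf.comp hR') (hg.comp hR')
    _ = D * (A * (C * (W' * ((W * ∫⁻ y in O, jetNormSq s (fun z => f (R • z)) y) *
          (W * ∫⁻ y in O, jetNormSq s (fun z => g (R • z)) y))))) := by
        generalize (∫⁻ y in O, jetNormSq s (fun z => f (R • z)) y) = a
        generalize (∫⁻ y in O, jetNormSq s (fun z => g (R • z)) y) = b
        calc _ = D * (A * (C * ((1 * W) * (a * b)))) := by ring
          _ = _ := by rw [← hW]; ring
    _ ≤ D * (A * (C * (W' * ((A * (D' * I)) * (A * (D' * J)))))) := by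
        gcongr D * (A * (C * (W' * ?_)))
        exact mul_le_mul' (hO' f hf) (hO' g hg)
    _ = (D * D') * (A ^ 3 * C * (W' * D') * I * J) := by ring
    _ = _ := by rw [hD, one_mul, ← ENNReal.ofReal_mul (by positivity)]

theorem exists_lintegral_weightedJetNormSq_mul_le [Nontrivial V] {s : ℕ}
    (hs : Module.finrank ℝ V < 2 * s) {δ : ℝ} (hδ : -(Module.finrank ℝ V : ℝ) / 2 < δ) :
    ∃ C : ℝ≥0∞, C ≠ ⊤ ∧ ∀ f g : V → ℝ, ContDiff ℝ ∞ f → ContDiff ℝ ∞ g →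
      ∫⁻ x, weightedJetNormSq s δ (fun y => f y * g y) x ≤
        C * (∫⁻ x, weightedJetNormSq s δ f x) * ∫⁻ x, weightedJetNormSq s δ g x := by
  obtain ⟨C₀, hC₀, h₀⟩ := exists_setLIntegral_weightedJetNormSq_mul_le hs δ (c := 17)
    (by norm_num) (isCompact_closedBall (0 : V) 1) (Metric.isOpen_ball (x := 0) (ε := 2))
    (Metric.closedBall_subset_ball (by norm_num))
  have hK : IsCompact {y : V | 1 ≤ ‖y‖ ∧ ‖y‖ ≤ 2} := by
    refine (isCompact_closedBall (0 : V) 2).of_isClosed_subset ?_ fun y hy => by simpa using hy.2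
    exact (isClosed_le continuous_const continuous_norm).inter
      (isClosed_le continuous_norm continuous_const)
  have hO : IsOpen {y : V | 1 / 2 < ‖y‖ ∧ ‖y‖ < 4} :=
    (isOpen_lt continuous_const continuous_norm).inter
      (isOpen_lt continuous_norm continuous_const)
  obtain ⟨C₁, hC₁, h₁⟩ := exists_setLIntegral_weightedJetNormSq_mul_le hs δ (c := 17)
    (by norm_num) hK hO fun y hy => ⟨by linarith [hy.1], by linarith [hy.2]⟩
  set d := Module.finrank ℝ V
  set r : ℝ≥0∞ := ENNReal.ofReal (2 ^ (-(2 * δ + d)))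
  have hr : r < 1 := by
    rw [ENNReal.ofReal_lt_one]
    exact Real.rpow_lt_one_of_one_lt_of_neg (by norm_num) (by linarith)
  have hpow : ∀ j : ℕ, ENNReal.ofReal ((((2 : ℝ) ^ j) ^ 2) ^ (-δ) * (((2 : ℝ) ^ j) ^ d)⁻¹) =
      r ^ j := fun j => by
    rw [← ENNReal.ofReal_pow (by positivity)]
    congr 1
    rw [← pow_mul, ← pow_mul, ← Real.rpow_natCast, ← Real.rpow_natCast, ← Real.rpow_natCast,
      ← Real.rpow_mul (by norm_num), ← Real.rpow_mul (by norm_num), ← Real.rpow_neg (by norm_num),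
      ← Real.rpow_add (by norm_num)]
    push_cast
    congr 1
    ring
  have hr' : (1 - r)⁻¹ ≠ ⊤ := by
    rw [ne_eq, ENNReal.inv_eq_top, tsub_eq_zero_iff_le, not_le]; exact hr
  refine ⟨C₀ + C₁ * (1 - r)⁻¹, by finiteness, fun f g hf hg => ?_⟩
  set I := ∫⁻ x, weightedJetNormSq s δ f x
  set J := ∫⁻ x, weightedJetNormSq s δ g x
  set S : ℕ → Set V := fun j => {x | (2 : ℝ) ^ j ≤ ‖x‖ ∧ ‖x‖ ≤ 2 ^ (j + 1)}
  have hS : ∀ j, MeasurableSet (S j) := fun j =>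
    ((isClosed_le continuous_const continuous_norm).inter
      (isClosed_le continuous_norm continuous_const)).measurableSet
  have hcover : Set.univ ⊆ Metric.closedBall (0 : V) 1 ∪ ⋃ j, S j := fun x _ => by
    rcases le_total ‖x‖ 1 with hx | hx
    · exact Or.inl (by simpa using hx)
    · obtain ⟨j, hj⟩ := exists_nat_pow_near hx one_lt_two
      exact Or.inr (Set.mem_iUnion.2 ⟨j, hj.1, hj.2.le⟩)
  have hball := h₀ 1 (Metric.closedBall 0 1) one_pos measurableSet_closedBall
    (fun y hy => by simpa using hy) (fun y hy => by
      have : ‖y‖ < 2 := by simpa using hy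
      have := norm_nonneg y
      rw [one_smul]
      constructor <;> nlinarith) f g hf hg
  have hann := fun j : ℕ => h₁ (2 ^ j) (S j) (by positivity) (hS j)
    (fun y hy => by
      have h2 : (0 : ℝ) < 2 ^ j := by positivity
      obtain ⟨ha, hb⟩ := hy
      rw [norm_smul, Real.norm_of_nonneg h2.le] at ha hb
      rw [pow_succ] at hb
      exact ⟨by nlinarith, le_of_mul_le_mul_left hb h2⟩)
    (fun y hy => by
      have h2 : (1 : ℝ) ≤ 2 ^ j := one_le_pow₀ (by norm_num)
      have h3 : (1 : ℝ) ≤ (2 ^ j) ^ 2 := one_le_pow₀ h2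
      obtain ⟨ha, hb⟩ := hy
      have ha' : 1 / 4 ≤ ‖y‖ ^ 2 := by nlinarith
      have hb' : ‖y‖ ^ 2 ≤ 16 := by nlinarith
      rw [norm_smul, Real.norm_of_nonneg (by positivity), mul_pow]
      constructor <;> nlinarith) f g hf hg
  calc ∫⁻ x, weightedJetNormSq s δ (fun y => f y * g y) x
      ≤ ∫⁻ x in Metric.closedBall (0 : V) 1 ∪ ⋃ j, S j,
          weightedJetNormSq s δ (fun y => f y * g y) x := by
        rw [← setLIntegral_univ]; exact lintegral_mono_set hcover
    _ ≤ (∫⁻ x in Metric.closedBall (0 : V) 1, weightedJetNormSq s δ (fun y => f y * g y) x) +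
          ∑' j, ∫⁻ x in S j, weightedJetNormSq s δ (fun y => f y * g y) x :=
        (lintegral_union_le _ _ _).trans (add_le_add le_rfl (lintegral_iUnion_le _ _))
    _ ≤ C₀ * I * J + ∑' j, C₁ * I * J * r ^ j := by
        gcongr with j
        · simpa using hball
        · refine (hann j).trans_eq ?_
          rw [hpow]; ring
    _ = _ := by rw [ENNReal.tsum_mul_left, ENNReal.tsum_geometric]; ring

end Weighted

theorem wSob_eq_lintegral_weightedJetNormSq {n s : ℕ} (δ : ℝ)
    {u : EuclideanSpace ℝ (Fin n) → ℝ} (hu : ContDiff ℝ (⊤ : ℕ∞) u) :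
    wSob n s δ u = (∫⁻ x, weightedJetNormSq s δ u x) ^ (1 / 2 : ℝ) := by
  unfold wSob weightedJetNormSq
  rw [lintegral_finsetSum]
  · congr 1
    refine Finset.sum_congr rfl fun k _ => lintegral_congr fun x => ?_
    rw [ENNReal.ofReal_mul (by positivity), ENNReal.ofReal_pow (norm_nonneg _), ofReal_norm]
  · intro k _
    have := (hu.continuous_enorm_iteratedFDeriv_sq k).measurable
    fun_prop

/-- **Banach algebra property of weighted Sobolev spaces**: if `s > n/2` and `δ > −n/2`,
then there is a constant `C = C(n, s, δ)` such that
`‖f·g‖_{H_{s,δ}(ℝⁿ)} ≤ C ‖f‖_{H_{s,δ}(ℝⁿ)} ‖g‖_{H_{s,δ}(ℝⁿ)}` for all smooth `f, g` with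
finite `H_{s,δ}(ℝⁿ)`-norm. -/
theorem weighted_sobolev_banach_algebra
    (n s : ℕ) (hn : 1 ≤ n) (hs : (n : ℝ) / 2 < (s : ℝ))
    (δ : ℝ) (hδ : -(n : ℝ) / 2 < δ) :
    ∃ C : ℝ, 0 < C ∧
      ∀ f g : EuclideanSpace ℝ (Fin n) → ℝ,
        ContDiff ℝ (⊤ : ℕ∞) f → ContDiff ℝ (⊤ : ℕ∞) g →
        wSob n s δ f < ⊤ → wSob n s δ g < ⊤ →
        wSob n s δ (fun x => f x * g x)
          ≤ ENNReal.ofReal C * wSob n s δ f * wSob n s δ g := by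
  have : NeZero n := ⟨by lia⟩
  have hs' : Module.finrank ℝ (EuclideanSpace ℝ (Fin n)) < 2 * s := by
    rw [finrank_euclideanSpace_fin]
    have : (n : ℝ) < 2 * s := by linarith
    exact_mod_cast this
  obtain ⟨C, hC, h⟩ := exists_lintegral_weightedJetNormSq_mul_le hs' (δ := δ)
    (by rwa [finrank_euclideanSpace_fin])
  refine ⟨(C ^ (1 / 2 : ℝ)).toReal + 1, by positivity, fun f g hf hg _ _ => ?_⟩
  rw [wSob_eq_lintegral_weightedJetNormSq δ (hf.mul hg),
    wSob_eq_lintegral_weightedJetNormSq δ hf, wSob_eq_lintegral_weightedJetNormSq δ hg]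
  calc _ ≤ _ := ENNReal.rpow_le_rpow (h f g hf hg) (by norm_num)
    _ = C ^ (1 / 2 : ℝ) * (∫⁻ x, weightedJetNormSq s δ f x) ^ (1 / 2 : ℝ) *
          (∫⁻ x, weightedJetNormSq s δ g x) ^ (1 / 2 : ℝ) := by
      rw [ENNReal.mul_rpow_of_nonneg _ _ (by norm_num), ENNReal.mul_rpow_of_nonneg _ _ (by norm_num)]
    _ ≤ _ := by
      gcongr
      rw [ENNReal.le_ofReal_iff_toReal_le (by finiteness) (by positivity)]
      linarith
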